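/- For every n, m ∈ ℕ and every point z on the graph of f_{c,b}, the number of b^{−n−m}-grid squares needed to cover (graph of f_{c,b}) ∩ Q(z, b^{−n}) is at most 3(10η + mη + 4)·b^m, where Q(z,ρ) is the closed square of center z and side 2ρ. -/

import Mathlib

open Set Filter

/-- Distance from `x` to the nearest integer. -/
noncomputable def phi (x : ℝ) : ℝ := |x - (round x : ℝ)|

/-- Least number of sets of diameter at most `r` needed to cover `E`. -/
noncomputable def coverNum {X : Type*} [PseudoMetricSpace X] (r : ℝ) (E : Set X) : ℕ :=
  sInf {n | ∃ 𝒰 : Finset (Set X), 𝒰.card = n ∧ (∀ U ∈ 𝒰, Metric.diam U ≤ r) ∧ E ⊆ ⋃₀ ↑𝒰}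

/-- Assouad dimension of a set, via covering numbers of balls at two scales. -/
noncomputable def assouadDim {X : Type*} [PseudoMetricSpace X] (F : Set X) : ℝ :=
  sInf {α : ℝ | 0 < α ∧ ∃ C : ℝ, 0 < C ∧ ∀ R r : ℝ, 0 < r → r < R → ∀ x ∈ F,
    (coverNum r (Metric.closedBall x R ∩ F) : ℝ) ≤ C * (R / r) ^ α}

/-- A square of a `δ`-mesh with offset `v`, indexed by `m ∈ ℤ × ℤ`. -/
noncomputable def gridSquare (v : ℝ × ℝ) (δ : ℝ) (m : ℤ × ℤ) : Set (ℝ × ℝ) :=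
  Icc (v.1 + m.1 * δ) (v.1 + (m.1 + 1) * δ) ×ˢ Icc (v.2 + m.2 * δ) (v.2 + (m.2 + 1) * δ)

/-- Least number of squares of a `δ`-mesh needed to cover `E`, over all possible `δ`-meshes. -/
noncomputable def gridCoverNum (δ : ℝ) (E : Set (ℝ × ℝ)) : ℕ :=
  sInf {n | ∃ (v : ℝ × ℝ) (t : Finset (ℤ × ℤ)), t.card = n ∧ E ⊆ ⋃ m ∈ t, gridSquare v δ m}

/-- Oscillation of `g` on `E`. -/
noncomputable def osc (g : ℝ → ℝ) (E : Set ℝ) : ℝ :=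
  sSup ((fun p : ℝ × ℝ => |g p.1 - g p.2|) '' (E ×ˢ E))

/-- Lower box dimension via covering numbers. -/
noncomputable def lowerBoxDim {X : Type*} [PseudoMetricSpace X] (F : Set X) : ℝ :=
  Filter.liminf (fun δ : ℝ => Real.log (coverNum δ F) / (-Real.log δ)) (nhdsWithin 0 (Set.Ioi 0))

/-- Upper box dimension via covering numbers. -/
noncomputable def upperBoxDim {X : Type*} [PseudoMetricSpace X] (F : Set X) : ℝ :=
  Filter.limsup (fun δ : ℝ => Real.log (coverNum δ F) / (-Real.log δ)) (nhdsWithin 0 (Set.Ioi 0))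

lemma exists_lo (Y : Set ℝ) (D : ℝ) (h : ∀ a ∈ Y, ∀ a' ∈ Y, a - a' ≤ D) :
    ∃ lo : ℝ, ∀ a ∈ Y, lo ≤ a ∧ a ≤ lo + D := by
  rcases Y.eq_empty_or_nonempty with rfl | hne
  · exact ⟨0, by simp⟩
  · refine ⟨sInf Y, fun a ha => ⟨csInf_le ⟨a - D, fun x hx => ?_⟩ ha, ?_⟩⟩
    · linarith [h a ha x hx]
    · have : a - D ≤ sInf Y := le_csInf hne (fun x hx => by linarith [h a ha x hx])
      linarith

lemma int_rows (lo D δ : ℝ) (hδ : 0 < δ) (hD : 0 ≤ D) :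
    ((Finset.Icc ⌊lo / δ⌋ ⌊(lo + D) / δ⌋).card : ℝ) ≤ D / δ + 2 := by
  rw [Int.card_Icc]
  have h1 : ⌊lo / δ⌋ ≤ ⌊(lo + D) / δ⌋ := Int.floor_le_floor (by gcongr; linarith)
  have h2 : ((⌊(lo + D) / δ⌋ + 1 - ⌊lo / δ⌋).toNat : ℝ)
      = (⌊(lo + D) / δ⌋ : ℝ) + 1 - ⌊lo / δ⌋ := by
    have : ((⌊(lo + D) / δ⌋ + 1 - ⌊lo / δ⌋).toNat : ℤ) = ⌊(lo + D) / δ⌋ + 1 - ⌊lo / δ⌋ :=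
      Int.toNat_of_nonneg (by omega)
    exact_mod_cast this
  rw [h2]
  have h3 := Int.floor_le ((lo + D) / δ)
  have h4 := Int.lt_floor_add_one (lo / δ)
  rw [add_div] at h3 ⊢
  linarith

lemma floor_mem (x δ : ℝ) (hδ : 0 < δ) :
    (⌊x / δ⌋ : ℝ) * δ ≤ x ∧ x ≤ ((⌊x / δ⌋ : ℝ) + 1) * δ := by
  constructor
  · exact (le_div_iff₀ hδ).1 (Int.floor_le _)
  · exact (div_le_iff₀ hδ).1 (Int.lt_floor_add_one _).le

lemma piece_cover (f G : ℝ → ℝ) (δ K R p q : ℝ) (hδ : 0 < δ) (hK : 0 ≤ K) (hpq : p ≤ q)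
    (S : Set ℝ) (hS : S ⊆ Icc p q) (hG : Monotone G) (hR : ∀ x y, G y - G x ≤ R)
    (hf : ∀ x ∈ S, ∀ y ∈ S, |x - y| ≤ δ → f x - f y ≤ |G x - G y| + K * δ) :
    ∃ t : Finset (ℤ × ℤ), (t.card : ℝ) ≤ R / δ + ((q - p) / δ + 2) * (K + 2) ∧
      (fun x => (x, f x)) '' S ⊆ ⋃ m ∈ t, gridSquare (0, 0) δ m := by
  set I0 := ⌊p / δ⌋ with hI0
  set I1 := ⌊q / δ⌋ with hI1
  have hI : I0 ≤ I1 := Int.floor_le_floor (by gcongr)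
  set a : ℕ → ℝ := fun j => G (((I0 : ℝ) + j) * δ) with ha
  have hmono : ∀ j, a j ≤ a (j + 1) := by
    intro j
    apply hG
    push_cast
    nlinarith
  have key : ∀ j : ℕ, ∃ lo : ℝ, ∀ y ∈ f '' (S ∩ Icc (((I0 : ℝ) + j) * δ) (((I0 : ℝ) + j + 1) * δ)),
      lo ≤ y ∧ y ≤ lo + (a (j + 1) - a j + K * δ) := by
    intro j
    apply exists_lo
    rintro _ ⟨x, ⟨hxS, hx1, hx2⟩, rfl⟩ _ ⟨y, ⟨hyS, hy1, hy2⟩, rfl⟩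
    have h1 := hf x hxS y hyS (by rw [abs_le]; constructor <;> linarith)
    have g1 := hG hx1
    have g2 := hG hx2
    have g3 := hG hy1
    have g4 := hG hy2
    have h2 : |G x - G y| ≤ a (j + 1) - a j := by
      simp only [ha]
      push_cast
      rw [← add_assoc, abs_le]
      constructor <;> linarith
    linarith
  choose lo hlo using key
  set D : ℕ → ℝ := fun j => a (j + 1) - a j + K * δ with hD
  have hD0 : ∀ j, 0 ≤ D j := fun j => by
    have := hmono j
    have := mul_nonneg hK hδ.le
    simp only [hD]; linarith
  classical
  set M := (I1 - I0 + 1).toNat with hM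
  have hMz : (M : ℤ) = I1 - I0 + 1 := Int.toNat_of_nonneg (by omega)
  refine ⟨(Finset.range M).biUnion (fun j =>
    (Finset.Icc ⌊lo j / δ⌋ ⌊(lo j + D j) / δ⌋).image (fun r => (I0 + (j : ℤ), r))), ?_, ?_⟩
  · have c1 : ((((Finset.range M).biUnion (fun j =>
        (Finset.Icc ⌊lo j / δ⌋ ⌊(lo j + D j) / δ⌋).image (fun r => (I0 + (j : ℤ), r)))).card : ℕ) : ℝ)
        ≤ ∑ j ∈ Finset.range M, (D j / δ + 2) := by
      refine le_trans (Nat.cast_le.2 Finset.card_biUnion_le) ?_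
      push_cast
      refine Finset.sum_le_sum (fun j _ => ?_)
      exact le_trans (Nat.cast_le.2 Finset.card_image_le) (int_rows _ _ _ hδ (hD0 j))
    have c2 : ∑ j ∈ Finset.range M, (D j / δ + 2) = (a M - a 0) / δ + M * (K + 2) := by
      rw [← Finset.sum_range_sub a M, Finset.sum_div]
      have : ∀ j ∈ Finset.range M, D j / δ + 2 = (a (j + 1) - a j) / δ + (K + 2) := by
        intro j _
        simp only [hD]
        field_simp
        ring
      rw [Finset.sum_congr rfl this, Finset.sum_add_distrib]
      simp
      ring
    have c3 : (a M - a 0) / δ ≤ R / δ := by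
      gcongr
      exact hR _ _
    have c4 : (M : ℝ) ≤ (q - p) / δ + 2 := by
      have e : (M : ℝ) = (I1 : ℝ) - I0 + 1 := by exact_mod_cast hMz
      have h3 := Int.floor_le (q / δ)
      have h4 := Int.lt_floor_add_one (p / δ)
      rw [e, sub_div]
      linarith
    have c5 : (M : ℝ) * (K + 2) ≤ ((q - p) / δ + 2) * (K + 2) := by gcongr
    linarith
  · rintro _ ⟨x, hx, rfl⟩
    have hxp := hS hx
    have i0 : I0 ≤ ⌊x / δ⌋ := Int.floor_le_floor (by gcongr; exact hxp.1)
    have i1 : ⌊x / δ⌋ ≤ I1 := Int.floor_le_floor (by gcongr; exact hxp.2)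
    obtain ⟨j, hj⟩ : ∃ j : ℕ, ⌊x / δ⌋ = I0 + j := ⟨(⌊x / δ⌋ - I0).toNat, by omega⟩
    have hjM : j < M := by omega
    have hjr : ((⌊x / δ⌋ : ℤ) : ℝ) = (I0 : ℝ) + j := by rw [hj]; push_cast; rfl
    have hfx := floor_mem x δ hδ
    have hfy := floor_mem (f x) δ hδ
    rw [hjr] at hfx
    have hl := hlo j (f x) ⟨x, ⟨hx, hfx.1, hfx.2⟩, rfl⟩
    simp only [mem_iUnion]
    refine ⟨(I0 + j, ⌊f x / δ⌋), ?_, ?_⟩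
    · simp only [Finset.mem_biUnion, Finset.mem_range, Finset.mem_image, Finset.mem_Icc]
      refine ⟨j, hjM, _, ⟨?_, ?_⟩, rfl⟩
      · exact Int.floor_le_floor (by gcongr; exact hl.1)
      · exact Int.floor_le_floor (by gcongr; exact hl.2)
    · simp only [gridSquare, mem_prod, mem_Icc]
      push_cast
      exact ⟨⟨by linarith [hfx.1], by linarith [hfx.2]⟩, ⟨by linarith [hfy.1], by linarith [hfy.2]⟩⟩

lemma phi_le_half (x : ℝ) : phi x ≤ 1 / 2 := abs_sub_round x

lemma phi_nonneg (x : ℝ) : 0 ≤ phi x := abs_nonneg _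

lemma phi_lip (x y : ℝ) : |phi x - phi y| ≤ |x - y| := by
  have h : ∀ x y : ℝ, phi x - phi y ≤ |x - y| := by
    intro x y
    have h1 : phi x ≤ |x - (round y : ℝ)| := round_le x (round y)
    have h2 := abs_sub_le x y (round y : ℝ)
    have h3 : phi y = |y - (round y : ℝ)| := rfl
    linarith
  rw [abs_le]
  have := h y x
  rw [abs_sub_comm] at this
  exact ⟨by linarith, h x y⟩

lemma phi_affine (l : ℤ) : ∃ α β : ℝ, ∀ x ∈ Icc ((l : ℝ) / 2) (((l : ℝ) + 1) / 2),
    phi x = α * x + β := by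
  have up : ∀ (r : ℤ) (x : ℝ), |x - r| ≤ 1 / 2 → phi x = |x - r| := by
    intro r x hx
    refine le_antisymm (round_le x r) ?_
    by_cases h : round x = r
    · simp [phi, h]
    · have h1 : (1 : ℝ) ≤ |((round x - r : ℤ) : ℝ)| := by
        have := Int.one_le_abs (sub_ne_zero.2 h)
        exact_mod_cast this
      push_cast at h1
      have h2 := abs_sub_le (round x : ℝ) x r
      rw [abs_sub_comm (round x : ℝ) x] at h2
      have : phi x = |x - round x| := rfl
      linarith
  rcases Int.even_or_odd' l with ⟨r, rfl | rfl⟩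
  · refine ⟨1, -r, fun x hx => ?_⟩
    push_cast at hx
    obtain ⟨h1, h2⟩ := hx
    have h3 : |x - r| = x - r := abs_of_nonneg (by linarith)
    rw [up r x (by rw [h3]; linarith), h3]; ring
  · refine ⟨-1, r + 1, fun x hx => ?_⟩
    push_cast at hx
    obtain ⟨h1, h2⟩ := hx
    have h3 : |x - ((r + 1 : ℤ) : ℝ)| = r + 1 - x := by
      push_cast
      rw [abs_of_nonpos (by linarith)]; ring
    rw [up (r + 1) x (by rw [h3]; linarith), h3]; ring

lemma partial_affine (b : ℕ) (hb : 2 ≤ b) (c : ℕ → ℝ) (n : ℕ) (j : ℤ) :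
    ∃ α β : ℝ, ∀ x ∈ Icc ((j : ℝ) * (b / (2 * (b : ℝ) ^ n))) (((j : ℝ) + 1) * (b / (2 * (b : ℝ) ^ n))),
      ∑ k ∈ Finset.range n, c k * phi ((b : ℝ) ^ k * x) = α * x + β := by
  have hb0 : (0 : ℝ) < b := by positivity
  have h : ∀ k : ℕ, ∃ α β : ℝ, k < n → ∀ x ∈ Icc ((j : ℝ) * (b / (2 * (b : ℝ) ^ n)))
      (((j : ℝ) + 1) * (b / (2 * (b : ℝ) ^ n))), phi ((b : ℝ) ^ k * x) = α * x + β := by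
    intro k
    by_cases hk : k < n
    · obtain ⟨d, rfl⟩ : ∃ d, n = k + 1 + d := ⟨n - k - 1, by omega⟩
      set e : ℤ := (b : ℤ) ^ d with he
      have he0 : 0 < e := by positivity
      obtain ⟨α, β, hab⟩ := phi_affine (j / e)
      refine ⟨α * b ^ k, β, fun _ x hx => ?_⟩
      have hs : (b : ℝ) ^ k * (b / (2 * (b : ℝ) ^ (k + 1 + d))) = 1 / (2 * (e : ℝ)) := by
        rw [he]; push_cast
        field_simp
        ring
      have heR : (0 : ℝ) < e := by exact_mod_cast he0
      have h1 : (((j / e : ℤ) : ℝ)) * e ≤ j := by exact_mod_cast Int.ediv_mul_le j he0.ne'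
      have h2 : (j : ℝ) + 1 ≤ (((j / e : ℤ) : ℝ) + 1) * e := by
        have := Int.lt_ediv_add_one_mul_self j he0
        exact_mod_cast this
      have hx1 := mul_le_mul_of_nonneg_left hx.1 (pow_pos hb0 k).le
      have hx2 := mul_le_mul_of_nonneg_left hx.2 (pow_pos hb0 k).le
      rw [mul_left_comm, hs] at hx1 hx2
      rw [hab]
      · ring
      · constructor
        · refine le_trans ?_ hx1
          rw [mul_one_div, div_le_div_iff₀ (by positivity) (by positivity)]
          linarith
        · refine le_trans hx2 ?_
          rw [mul_one_div, div_le_div_iff₀ (by positivity) (by positivity)]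
          linarith
    · exact ⟨0, 0, fun h => absurd h hk⟩
  choose α β hab using h
  refine ⟨∑ k ∈ Finset.range n, c k * α k, ∑ k ∈ Finset.range n, c k * β k, fun x hx => ?_⟩
  rw [Finset.sum_mul, ← Finset.sum_add_distrib]
  refine Finset.sum_congr rfl (fun k hk => ?_)
  rw [hab k (Finset.mem_range.1 hk) x hx]; ring

lemma term_summable (b : ℕ) (hb : 2 ≤ b) (c : ℕ → ℝ) (η : ℝ) (hη : 1 ≤ η)
    (hc : ∀ k : ℕ, |c k| ≤ η * ((b : ℝ) ^ k)⁻¹) (x : ℝ) :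
    Summable (fun k : ℕ => c k * phi ((b : ℝ) ^ k * x)) := by
  have hb1 : ((b : ℝ))⁻¹ < 1 := inv_lt_one_of_one_lt₀ (by exact_mod_cast hb)
  refine Summable.of_norm_bounded
    ((summable_geometric_of_lt_one (by positivity) hb1).mul_left η) (fun k => ?_)
  rw [Real.norm_eq_abs, abs_mul, abs_of_nonneg (phi_nonneg _), inv_pow]
  have := hc k
  have h1 := phi_le_half ((b : ℝ) ^ k * x)
  have h2 := phi_nonneg ((b : ℝ) ^ k * x)
  nlinarith [abs_nonneg (c k)]

lemma tail_bound (b : ℕ) (hb : 2 ≤ b) (c : ℕ → ℝ) (η : ℝ) (hη : 1 ≤ η)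
    (hc : ∀ k : ℕ, |c k| ≤ η * ((b : ℝ) ^ k)⁻¹) (N : ℕ) (x y : ℝ) :
    |(∑' k : ℕ, c (k + N) * phi ((b : ℝ) ^ (k + N) * x)) -
      ∑' k : ℕ, c (k + N) * phi ((b : ℝ) ^ (k + N) * y)| ≤ η * ((b : ℝ) ^ N)⁻¹ := by
  have hb2 : (2 : ℝ) ≤ b := by exact_mod_cast hb
  have hb1 : ((b : ℝ))⁻¹ ≤ 1 / 2 := by
    rw [one_div]; gcongr
  have sx := (summable_nat_add_iff N).2 (term_summable b hb c η hη hc x)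
  have sy := (summable_nat_add_iff N).2 (term_summable b hb c η hη hc y)
  rw [← sx.tsum_sub sy, ← Real.norm_eq_abs]
  have hg := (hasSum_geometric_two).mul_left (η * ((b : ℝ) ^ N)⁻¹ / 2)
  refine le_trans (tsum_of_norm_bounded hg (fun k => ?_)) (by linarith)
  rw [← mul_sub, Real.norm_eq_abs, abs_mul]
  have h0 : |phi ((b : ℝ) ^ (k + N) * x) - phi ((b : ℝ) ^ (k + N) * y)| ≤ 1 / 2 := by
    rw [abs_le]
    constructor <;> linarith [phi_le_half ((b : ℝ) ^ (k + N) * x), phi_nonneg ((b : ℝ) ^ (k + N) * x),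
      phi_le_half ((b : ℝ) ^ (k + N) * y), phi_nonneg ((b : ℝ) ^ (k + N) * y)]
  have h1 : ((b : ℝ) ^ (k + N))⁻¹ ≤ (1 / 2) ^ k * ((b : ℝ) ^ N)⁻¹ := by
    rw [pow_add, mul_inv, ← inv_pow]
    gcongr
  calc _ ≤ (η * ((1 / 2) ^ k * ((b : ℝ) ^ N)⁻¹)) * (1 / 2) := by
        refine mul_le_mul ((hc _).trans ?_) h0 (abs_nonneg _) (by positivity)
        gcongr
    _ = _ := by ring

lemma mid_bound (b : ℕ) (hb : 2 ≤ b) (c : ℕ → ℝ) (η : ℝ) (hη : 1 ≤ η)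
    (hc : ∀ k : ℕ, |c k| ≤ η * ((b : ℝ) ^ k)⁻¹) (n m : ℕ) (x y δ : ℝ) (hxy : |x - y| ≤ δ) :
    |(∑ k ∈ Finset.range m, c (k + n) * phi ((b : ℝ) ^ (k + n) * x)) -
      ∑ k ∈ Finset.range m, c (k + n) * phi ((b : ℝ) ^ (k + n) * y)| ≤ m * (η * δ) := by
  have hb0 : (0 : ℝ) < b := by positivity
  rw [← Finset.sum_sub_distrib]
  refine le_trans (Finset.abs_sum_le_sum_abs _ _) ?_
  refine le_trans (Finset.sum_le_card_nsmul _ _ (η * δ) (fun k _ => ?_)) (by simp)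
  rw [← mul_sub, abs_mul]
  have h := phi_lip ((b : ℝ) ^ (k + n) * x) ((b : ℝ) ^ (k + n) * y)
  rw [← mul_sub, abs_mul, abs_of_pos (pow_pos hb0 _)] at h
  calc _ ≤ (η * ((b : ℝ) ^ (k + n))⁻¹) * ((b : ℝ) ^ (k + n) * |x - y|) :=
        mul_le_mul (hc _) h (abs_nonneg _) (by positivity)
    _ = η * |x - y| := by field_simp
    _ ≤ _ := by gcongr

/-- One affine piece of the graph. -/
lemma affine_piece (b : ℕ) (hb : 2 ≤ b) (c : ℕ → ℝ) (η : ℝ) (hη : 1 ≤ η)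
    (hc : ∀ k : ℕ, |c k| ≤ η * ((b : ℝ) ^ k)⁻¹) (n m : ℕ) (x0 p q : ℝ) (hpq : p ≤ q)
    (α β : ℝ) (hab : ∀ x ∈ Icc p q,
      ∑ k ∈ Finset.range n, c k * phi ((b : ℝ) ^ k * x) = α * x + β)
    (f : ℝ → ℝ) (hf : f = fun x => ∑' k : ℕ, c k * phi ((b : ℝ) ^ k * x)) :
    ∃ t : Finset (ℤ × ℤ), (t.card : ℝ) ≤ 2 * (1 + η) * (b : ℝ) ^ m +
        ((q - p) / ((b : ℝ) ^ (n + m))⁻¹ + 2) * ((m + 1) * η + 2) ∧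
      (fun x => (x, f x)) '' {x | x ∈ Icc p q ∧ |f x - f x0| ≤ ((b : ℝ) ^ n)⁻¹} ⊆
        ⋃ m' ∈ t, gridSquare (0, 0) ((b : ℝ) ^ (n + m))⁻¹ m' := by
  have hb0 : (0 : ℝ) < b := by positivity
  set w := ((b : ℝ) ^ n)⁻¹ with hw
  set δ := ((b : ℝ) ^ (n + m))⁻¹ with hδd
  have hδ : 0 < δ := by positivity
  have hw0 : 0 < w := by positivity
  set P : ℝ → ℝ := fun x => ∑ k ∈ Finset.range n, c k * phi ((b : ℝ) ^ k * x) with hP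
  set T : ℝ → ℝ := fun x => ∑' k : ℕ, c (k + n) * phi ((b : ℝ) ^ (k + n) * x) with hT
  have hfPT : ∀ x, f x = P x + T x := fun x => by
    rw [hf]
    exact ((term_summable b hb c η hη hc x).sum_add_tsum_nat_add n).symm
  have hTw : ∀ x y, |T x - T y| ≤ η * w := fun x y => tail_bound b hb c η hη hc n x y
  have hTd : ∀ x y, |x - y| ≤ δ → |T x - T y| ≤ ((m + 1) * η) * δ := by
    intro x y hxy
    have hdec : ∀ x, T x = (∑ k ∈ Finset.range m, c (k + n) * phi ((b : ℝ) ^ (k + n) * x)) +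
        ∑' k : ℕ, c (k + (n + m)) * phi ((b : ℝ) ^ (k + (n + m)) * x) := by
      intro x
      have := (((summable_nat_add_iff n).2
        (term_summable b hb c η hη hc x)).sum_add_tsum_nat_add m).symm
      simp only [hT]
      rw [this]
      congr 1
      refine tsum_congr (fun k => ?_)
      rw [show k + m + n = k + (n + m) by ring]
    have h1 := abs_le.1 (mid_bound b hb c η hη hc n m x y δ hxy)
    have h2 := abs_le.1 (tail_bound b hb c η hη hc (n + m) x y)
    rw [← hδd] at h2
    rw [hdec x, hdec y, abs_le]
    constructor <;> linarith [h1.1, h1.2, h2.1, h2.2]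
  set A := P x0 - (1 + η) * w with hA
  set B := P x0 + (1 + η) * w with hB
  have hAB : A ≤ B := by
    have : 0 ≤ (1 + η) * w := by positivity
    linarith
  have hmem : ∀ x, |f x - f x0| ≤ w → A ≤ P x ∧ P x ≤ B := by
    intro x hx
    have h1 := abs_le.1 hx
    have h2 := abs_le.1 (hTw x x0)
    rw [hfPT x, hfPT x0] at h1
    constructor <;> linarith [h1.1, h1.2, h2.1, h2.2]
  have hcl : ∀ u v : ℝ, u ≤ v → max A (min B u) ≤ max A (min B v) := fun u v h => by gcongr
  have hrange : ∀ u : ℝ, A ≤ max A (min B u) ∧ max A (min B u) ≤ B := fun u =>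
    ⟨le_max_left _ _, max_le hAB (min_le_left _ _)⟩
  have hid : ∀ u : ℝ, A ≤ u → u ≤ B → max A (min B u) = u := fun u h1 h2 => by
    rw [min_eq_right h2, max_eq_right h1]
  have hcard : (B - A) / δ = 2 * (1 + η) * (b : ℝ) ^ m := by
    rw [hA, hB, hδd, hw, pow_add]
    field_simp
    ring
  have hdiff : ∀ x ∈ {x | x ∈ Icc p q ∧ |f x - f x0| ≤ w},
      ∀ y ∈ {x | x ∈ Icc p q ∧ |f x - f x0| ≤ w}, |x - y| ≤ δ →
      f x - f y ≤ |max A (min B (α * x + β)) - max A (min B (α * y + β))|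
        + ((m + 1) * η) * δ := by
    intro x hx y hy hxy
    have h1 := hmem x hx.2
    have h2 := hmem y hy.2
    have e1 : P x = α * x + β := hab x hx.1
    have e2 : P y = α * y + β := hab y hy.1
    rw [← e1, ← e2, hid _ h1.1 h1.2, hid _ h2.1 h2.2, hfPT x, hfPT y]
    have := (abs_le.1 (hTd x y hxy)).2
    linarith [le_abs_self (P x - P y)]
  rw [← hcard]
  rcases le_total 0 α with hα | hα
  · refine piece_cover f (fun x => max A (min B (α * x + β))) δ _ (B - A) p q hδ (by positivity)
      hpq _ (fun x hx => hx.1) ?_ ?_ hdiff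
    · intro x y hxy
      exact hcl _ _ (by nlinarith)
    · intro x y
      linarith [(hrange (α * x + β)).1, (hrange (α * y + β)).2]
  · refine piece_cover f (fun x => - max A (min B (α * x + β))) δ _ (B - A) p q hδ (by positivity)
      hpq _ (fun x hx => hx.1) ?_ ?_ ?_
    · intro x y hxy
      exact neg_le_neg (hcl _ _ (by nlinarith))
    · intro x y
      linarith [(hrange (α * x + β)).2, (hrange (α * y + β)).1]
    · intro x hx y hy hxy
      have := hdiff x hx y hy hxy
      rwa [neg_sub_neg, abs_sub_comm]

theorem graph_grid_cover_bound (b : ℕ) (hb : 2 ≤ b) (c : ℕ → ℝ) (η : ℝ) (hη : 1 ≤ η)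
    (hc : ∀ k : ℕ, |c k| ≤ η * ((b : ℝ) ^ k)⁻¹) (n m : ℕ) (z : ℝ × ℝ)
    (hz : z ∈ (fun x : ℝ => (x, ∑' k : ℕ, c k * phi ((b : ℝ) ^ k * x))) '' Icc (0 : ℝ) 1) :
    (gridCoverNum (((b : ℝ) ^ (n + m))⁻¹)
        (((fun x : ℝ => (x, ∑' k : ℕ, c k * phi ((b : ℝ) ^ k * x))) '' Icc (0 : ℝ) 1) ∩
          (Icc (z.1 - ((b : ℝ) ^ n)⁻¹) (z.1 + ((b : ℝ) ^ n)⁻¹) ×ˢ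
            Icc (z.2 - ((b : ℝ) ^ n)⁻¹) (z.2 + ((b : ℝ) ^ n)⁻¹))) : ℝ) ≤
      3 * (10 * η + m * η + 4) * (b : ℝ) ^ m := by 
  have hb0 : (0 : ℝ) < b := by positivity
  have hb2 : (2 : ℝ) ≤ b := by exact_mod_cast hb
  obtain ⟨x0, hx0, rfl⟩ := hz
  set f : ℝ → ℝ := fun x => ∑' k : ℕ, c k * phi ((b : ℝ) ^ k * x) with hf
  set w := ((b : ℝ) ^ n)⁻¹ with hw
  have hw0 : 0 < w := by positivity
  set s : ℝ := b / (2 * (b : ℝ) ^ n) with hs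
  have hsw : w ≤ s := by
    rw [hs, hw, inv_eq_one_div, div_le_div_iff₀ (by positivity) (by positivity)]
    nlinarith [pow_pos hb0 n]
  have hs0 : 0 < s := hw0.trans_le hsw
  set j := ⌊x0 / s⌋ with hj
  obtain ⟨hj1, hj2⟩ := floor_mem x0 s hs0
  rw [← hj] at hj1 hj2
  set p1 := max (x0 - w) (j * s) with hp1
  set p2 := min (x0 + w) ((j + 1) * s) with hp2
  have l1 : x0 - w ≤ p1 := le_max_left _ _
  have l2 : p1 ≤ x0 := max_le (by linarith) hj1
  have l3 : x0 ≤ p2 := le_min (by linarith) hj2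
  have l4 : p2 ≤ x0 + w := min_le_left _ _
  have a1 : ∃ α β : ℝ, ∀ x ∈ Icc (x0 - w) p1,
      ∑ k ∈ Finset.range n, c k * phi ((b : ℝ) ^ k * x) = α * x + β := by
    rcases le_total (j * s) (x0 - w) with h | h
    · have e : p1 = x0 - w := max_eq_left h
      refine ⟨0, ∑ k ∈ Finset.range n, c k * phi ((b : ℝ) ^ k * (x0 - w)), fun x hx => ?_⟩
      rw [e] at hx
      rw [le_antisymm hx.2 hx.1]; ring
    · have e : p1 = j * s := max_eq_right h
      obtain ⟨α, β, hab⟩ := partial_affine b hb c n (j - 1)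
      refine ⟨α, β, fun x hx => hab x ?_⟩
      rw [← hs]
      push_cast
      rw [e] at hx
      exact ⟨by linarith [hx.1], by linarith [hx.2]⟩
  have a2 : ∃ α β : ℝ, ∀ x ∈ Icc p1 p2,
      ∑ k ∈ Finset.range n, c k * phi ((b : ℝ) ^ k * x) = α * x + β := by
    obtain ⟨α, β, hab⟩ := partial_affine b hb c n j
    refine ⟨α, β, fun x hx => hab x ?_⟩
    exact ⟨(le_max_right _ _).trans hx.1, hx.2.trans (min_le_right _ _)⟩
  have a3 : ∃ α β : ℝ, ∀ x ∈ Icc p2 (x0 + w),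
      ∑ k ∈ Finset.range n, c k * phi ((b : ℝ) ^ k * x) = α * x + β := by
    rcases le_total (x0 + w) ((j + 1) * s) with h | h
    · have e : p2 = x0 + w := min_eq_left h
      refine ⟨0, ∑ k ∈ Finset.range n, c k * phi ((b : ℝ) ^ k * (x0 + w)), fun x hx => ?_⟩
      rw [e] at hx
      rw [le_antisymm hx.2 hx.1]; ring
    · have e : p2 = (j + 1) * s := min_eq_right h
      obtain ⟨α, β, hab⟩ := partial_affine b hb c n (j + 1)
      refine ⟨α, β, fun x hx => hab x ?_⟩
      rw [← hs]
      push_cast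
      rw [e] at hx
      exact ⟨by linarith [hx.1], by linarith [hx.2]⟩
  obtain ⟨α1, β1, a1⟩ := a1
  obtain ⟨α2, β2, a2⟩ := a2
  obtain ⟨α3, β3, a3⟩ := a3
  obtain ⟨t1, k1, u1⟩ := affine_piece b hb c η hη hc n m x0 _ _ l1 α1 β1 a1 f hf
  obtain ⟨t2, k2, u2⟩ := affine_piece b hb c η hη hc n m x0 _ _ (l2.trans l3) α2 β2 a2 f hf
  obtain ⟨t3, k3, u3⟩ := affine_piece b hb c η hη hc n m x0 _ _ l4 α3 β3 a3 f hf
  rw [← hw] at u1 u2 u3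
  set δ := ((b : ℝ) ^ (n + m))⁻¹ with hδ
  classical
  have hle : gridCoverNum δ (((fun x : ℝ => (x, f x)) '' Icc (0 : ℝ) 1) ∩
      (Icc (x0 - w) (x0 + w) ×ˢ Icc (f x0 - w) (f x0 + w))) ≤ (t1 ∪ t2 ∪ t3).card := by
    refine Nat.sInf_le ⟨(0, 0), t1 ∪ t2 ∪ t3, rfl, ?_⟩
    rintro _ ⟨⟨x, hx, rfl⟩, ⟨h1, h2⟩, h3, h4⟩
    simp only at h1 h2 h3 h4
    have hv : |f x - f x0| ≤ w := by rw [abs_le]; constructor <;> linarith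
    have mono : ∀ t ⊆ t1 ∪ t2 ∪ t3, (⋃ m' ∈ t, gridSquare (0, 0) δ m') ⊆
        ⋃ m' ∈ t1 ∪ t2 ∪ t3, gridSquare (0, 0) δ m' := fun t ht =>
      biUnion_subset_biUnion_left (fun a ha => ht ha)
    rcases le_total x p1 with h | h
    · exact mono t1 (fun a ha => by simp [ha]) (u1 ⟨x, ⟨⟨h1, h⟩, hv⟩, rfl⟩)
    · rcases le_total x p2 with h' | h'
      · exact mono t2 (fun a ha => by simp [ha]) (u2 ⟨x, ⟨⟨h, h'⟩, hv⟩, rfl⟩)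
      · exact mono t3 (fun a ha => by simp [ha]) (u3 ⟨x, ⟨⟨h', h2⟩, hv⟩, rfl⟩)
  have hcard : ((t1 ∪ t2 ∪ t3).card : ℝ) ≤ t1.card + t2.card + t3.card := by
    have h1 := Finset.card_union_le (t1 ∪ t2) t3
    have h2 := Finset.card_union_le t1 t2
    exact_mod_cast (by omega : (t1 ∪ t2 ∪ t3).card ≤ t1.card + t2.card + t3.card)
  have hle' := (Nat.cast_le (α := ℝ)).2 hle
  refine hle'.trans (hcard.trans ?_)
  have hwd : w / δ = (b : ℝ) ^ m := by
    rw [hw, hδ, pow_add]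
    field_simp
  set B := (b : ℝ) ^ m with hB
  have hBm : (m : ℝ) + 1 ≤ B := by
    have h1 : m < b ^ m := Nat.lt_pow_self (by omega)
    have h2 : m + 1 ≤ b ^ m := h1
    rw [hB]
    exact_mod_cast h2
  have hm0 : (0 : ℝ) ≤ m := Nat.cast_nonneg m
  have hsum : ((p1 - (x0 - w)) / δ + 2) * ((m + 1) * η + 2) + ((p2 - p1) / δ + 2) * ((m + 1) * η + 2)
      + ((x0 + w - p2) / δ + 2) * ((m + 1) * η + 2) = (2 * B + 6) * ((m + 1) * η + 2) := by
    rw [← hwd]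
    ring
  have f1 : (m + 1) * η ≤ B * η := by gcongr
  have f2 : B ≤ η * B := by nlinarith
  have f3 : 0 ≤ m * η * B := by positivity
  nlinarith
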